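/- Let (E, ℰ, μ) be a probability space, let g, ĝ : E → ℝ be measurable, let p ≥ 1 and γ > 0. Define Ω_f = {z : g(z) < 0} and Ω̃_f = {z : ĝ(z) < −γ} ∪ ({z : |ĝ(z)| ≤ γ} ∩ {z : g(z) < 0}). Then μ(Ω_f Δ Ω̃_f) ≤ γ^{−p} ∫_E |g(z) − ĝ(z)|^p dμ(z). -/

import Mathlib

open MeasureTheory

/-- Outside the points where `g` and `ghat` differ by more than `γ`, the failure domain and the
hybrid approximate failure domain agree. -/
lemma hybrid_symmDiff_subset {E : Type*} (g ghat : E → ℝ) (γ : ℝ) :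
    symmDiff {z | g z < 0} ({z | ghat z < -γ} ∪ ({z | |ghat z| ≤ γ} ∩ {z | g z < 0})) ⊆
      {z | γ ≤ |g z - ghat z|} := by
  rintro z (⟨hz, hz'⟩ | ⟨hz | ⟨-, hz⟩, hz'⟩)
  · simp only [Set.mem_union, Set.mem_inter_iff, Set.mem_ofPred_eq, not_or, not_and', not_lt,
      not_le] at hz hz' ⊢
    rcases lt_abs.1 (hz'.2 hz) with h | h
    · exact le_abs.2 (Or.inr (by linarith))
    · linarith [hz'.1]
  · simp only [Set.mem_ofPred_eq, not_lt] at hz hz' ⊢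
    exact le_abs.2 (Or.inl (by linarith))
  · exact absurd hz hz'

/-- Chebyshev-type bound for the hybrid method: the measure of the symmetric difference
between the failure domain `Ω_f = {g < 0}` and the hybrid approximate failure domain
`Ω̃_f = {ĝ < -γ} ∪ ({|ĝ| ≤ γ} ∩ {g < 0})` is at most `γ^{-p} ∫ |g - ĝ|^p dμ`. -/
theorem hybrid_symmDiff_measure_le {E : Type*} [MeasurableSpace E]
    (μ : Measure E) [IsProbabilityMeasure μ]
    (g ghat : E → ℝ) (hg : Measurable g) (hghat : Measurable ghat)
    (p : ℝ) (hp : 1 ≤ p) (γ : ℝ) (hγ : 0 < γ) :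
    μ (symmDiff {z | g z < 0}
        ({z | ghat z < -γ} ∪ ({z | |ghat z| ≤ γ} ∩ {z | g z < 0}))) ≤
      ENNReal.ofReal (γ ^ (-p)) *
        ∫⁻ z, ENNReal.ofReal (|g z - ghat z| ^ p) ∂μ := by
  have hp0 : 0 ≤ p := zero_le_one.trans hp
  have hpow : 0 < γ ^ p := Real.rpow_pos_of_pos hγ p
  rw [Real.rpow_neg hγ.le, ENNReal.ofReal_inv_of_pos hpow, mul_comm, ← div_eq_mul_inv]
  refine (measure_mono ?_).trans (meas_ge_le_lintegral_div (by fun_prop)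
    (ENNReal.ofReal_pos.2 hpow).ne' ENNReal.ofReal_ne_top)
  exact (hybrid_symmDiff_subset g ghat γ).trans fun z hz =>
    ENNReal.ofReal_le_ofReal (Real.rpow_le_rpow hγ.le hz hp0)
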